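/- Let G = (V, E) and G' = (V, E') be finite connected simple graphs on the same vertex set V, and let c, c' be positive integers. Suppose the edge set E' − E = {e ∈ E' : e ∉ E} can be partitioned into pairwise disjoint sets E'_1, …, E'_c such that for every i ∈ [c] and every subset F ⊆ E'_i consisting of pairwise vertex-disjoint edges, the involution π_F of V that swaps the two endpoints of every edge of F (and fixes all other vertices) satisfies rt(G, π_F) ≤ c'. Then rt(G) ≤ (1 + c·c') · rt(G'). -/

import Mathlib

/-- A routing round on `G`: the swap permutation of a matching of `G`, i.e. an involution
of the vertices that moves vertices only along edges of `G`. -/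
def isRound {V : Type*} (G : SimpleGraph V) (σ : Equiv.Perm V) : Prop :=
  σ * σ = 1 ∧ ∀ v : V, σ v ≠ v → G.Adj v (σ v)

/-- Composition, in order, of a list of round permutations: for `L = [σ₁, …, σₘ]`,
`rComp L = σₘ ∘ ⋯ ∘ σ₁`. -/
def rComp {V : Type*} (L : List (Equiv.Perm V)) : Equiv.Perm V :=
  L.foldl (fun p σ => σ * p) 1

/-- `rt(G, π)`: the minimum number of routing rounds (matchings of `G`) whose swap
permutations, composed in order, realize the permutation `π`. -/
noncomputable def rtP {V : Type*} (G : SimpleGraph V) (π : Equiv.Perm V) : ℕ :=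
  sInf {m | ∃ L : List (Equiv.Perm V), L.length = m ∧ (∀ σ ∈ L, isRound G σ) ∧ rComp L = π}

/-- `rt(G)`: the routing number of `G`, the maximum of `rt(G, π)` over all permutations. -/
noncomputable def rt {V : Type*} [Fintype V] [DecidableEq V] (G : SimpleGraph V) : ℕ :=
  Finset.univ.sup (rtP G)

theorem rComp_eq_prod_reverse {V : Type*} (L : List (Equiv.Perm V)) :
    rComp L = L.reverse.prod := by
  rw [rComp, List.prod_eq_foldr, List.foldr_reverse]

/-- `π` can be realized by at most `m` routing rounds on `G`. -/
def Routable {V : Type*} (G : SimpleGraph V) (m : ℕ) (π : Equiv.Perm V) : Prop :=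
  ∃ L : List (Equiv.Perm V), L.length ≤ m ∧ (∀ σ ∈ L, isRound G σ) ∧ rComp L = π

namespace Routable

variable {V : Type*} {G : SimpleGraph V} {m n : ℕ} {π ρ : Equiv.Perm V}

theorem rtP_le (h : Routable G m π) : rtP G π ≤ m := by
  obtain ⟨L, hL, hr, hπ⟩ := h
  exact le_trans (Nat.sInf_le (m := L.length) ⟨L, rfl, hr, hπ⟩) hL

theorem one : Routable G 0 (1 : Equiv.Perm V) :=
  ⟨[], le_rfl, by simp, rfl⟩

theorem of_isRound (h : isRound G π) : Routable G 1 π :=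
  ⟨[π], le_rfl, by simpa using h, by simp [rComp_eq_prod_reverse]⟩

theorem mono (h : Routable G m π) (hmn : m ≤ n) : Routable G n π := by
  obtain ⟨L, hL, hr, hπ⟩ := h
  exact ⟨L, hL.trans hmn, hr, hπ⟩

theorem mul (hπ : Routable G m π) (hρ : Routable G n ρ) : Routable G (m + n) (π * ρ) := by
  obtain ⟨L, hL, hLr, rfl⟩ := hπ
  obtain ⟨K, hK, hKr, rfl⟩ := hρ
  refine ⟨K ++ L, by simp only [List.length_append]; omega, ?_, ?_⟩
  · intro σ hσ
    exact (List.mem_append.1 hσ).elim (hKr σ) (hLr σ)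
  · simp [rComp_eq_prod_reverse]

end Routable

theorem isRound_swap {V : Type*} [DecidableEq V] {G : SimpleGraph V} {a b : V}
    (h : G.Adj a b) : isRound G (Equiv.swap a b) := by
  refine ⟨Equiv.swap_mul_self a b, fun v hv => ?_⟩
  by_cases ha : v = a
  · subst ha; simpa using h
  by_cases hb : v = b
  · subst hb; simpa using h.symm
  exact absurd (Equiv.swap_apply_of_ne_of_ne ha hb) hv

/-- The swaps along the edges of a connected graph generate the symmetric group. -/
theorem SimpleGraph.Connected.closure_swap_eq_top {V : Type*} [Finite V] [DecidableEq V]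
    {G : SimpleGraph V} (hG : G.Connected) :
    Subgroup.closure {σ : Equiv.Perm V | ∃ a b, G.Adj a b ∧ σ = Equiv.swap a b} = ⊤ := by
  set S := {σ : Equiv.Perm V | ∃ a b, G.Adj a b ∧ σ = Equiv.swap a b}
  have hreach : ∀ a b : V, G.Reachable a b → ∃ g : Subgroup.closure S, g • a = b := by
    rintro a b ⟨w⟩
    induction w with
    | nil => exact ⟨1, one_smul _ _⟩
    | @cons u v w h _ ih =>
      obtain ⟨g, hg⟩ := ih
      refine ⟨g * ⟨Equiv.swap u v, Subgroup.subset_closure ⟨u, v, h, rfl⟩⟩, ?_⟩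
      rw [mul_smul, ← hg]
      congr 1
      exact Equiv.swap_apply_left u v
  have : MulAction.IsPretransitive (Subgroup.closure S) V :=
    ⟨fun a b => hreach a b (hG.preconnected a b)⟩
  refine closure_of_isSwap_of_isPretransitive ?_
  rintro _ ⟨a, b, h, rfl⟩
  exact ⟨a, b, h.ne, rfl⟩

/-- On a connected graph every permutation can be routed. -/
theorem SimpleGraph.Connected.exists_routable {V : Type*} [Finite V] [DecidableEq V]
    {G : SimpleGraph V} (hG : G.Connected) (π : Equiv.Perm V) : ∃ m, Routable G m π := by
  have hπ : π ∈ (Subgroup.closure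
      {σ : Equiv.Perm V | ∃ a b, G.Adj a b ∧ σ = Equiv.swap a b}).toSubmonoid := by
    rw [hG.closure_swap_eq_top]; trivial
  rw [Subgroup.closure_toSubmonoid_of_finite] at hπ
  induction hπ using Submonoid.closure_induction with
  | mem σ hσ =>
    obtain ⟨a, b, h, rfl⟩ := hσ
    exact ⟨1, .of_isRound (isRound_swap h)⟩
  | one => exact ⟨0, .one⟩
  | mul σ τ _ _ hσ hτ =>
    obtain ⟨m, hm⟩ := hσ
    obtain ⟨n, hn⟩ := hτ
    exact ⟨m + n, hm.mul hn⟩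

theorem SimpleGraph.Connected.routable_rtP {V : Type*} [Finite V] [DecidableEq V]
    {G : SimpleGraph V} (hG : G.Connected) (π : Equiv.Perm V) : Routable G (rtP G π) π := by
  obtain ⟨m, L, -, hr, hπ⟩ := hG.exists_routable π
  obtain ⟨K, hK, hKr, hKπ⟩ := Nat.sInf_mem
    (s := {m | ∃ L : List (Equiv.Perm V), L.length = m ∧ (∀ σ ∈ L, isRound G σ) ∧ rComp L = π})
    ⟨_, L, rfl, hr, hπ⟩
  exact ⟨K, hK.le, hKr, hKπ⟩

open Classical in
/-- The part of an involution `σ` that swaps only the pairs belonging to `S`. -/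
noncomputable def involutionRestrict {V : Type*} (σ : Equiv.Perm V) (hσ : σ * σ = 1)
    (S : Set (Sym2 V)) : Equiv.Perm V :=
  Function.Involutive.toPerm (fun x => if s(x, σ x) ∈ S then σ x else x) <| by
    intro x
    have hx : σ (σ x) = x := DFunLike.congr_fun hσ x
    by_cases h : s(x, σ x) ∈ S
    · have h' : s(σ x, x) ∈ S := by rwa [Sym2.eq_swap]
      simp [h, h', hx]
    · simp [h]

section involutionRestrict

variable {V : Type*} {σ : Equiv.Perm V} (hσ : σ * σ = 1) {S T : Set (Sym2 V)} {x : V}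

theorem involutionRestrict_of_mem (h : s(x, σ x) ∈ S) : involutionRestrict σ hσ S x = σ x :=
  if_pos h

theorem involutionRestrict_of_notMem (h : s(x, σ x) ∉ S) : involutionRestrict σ hσ S x = x :=
  if_neg h

theorem mem_of_involutionRestrict_ne (h : involutionRestrict σ hσ S x ≠ x) :
    s(x, involutionRestrict σ hσ S x) ∈ S := by
  by_cases hx : s(x, σ x) ∈ S
  · rwa [involutionRestrict_of_mem hσ hx]
  · exact absurd (involutionRestrict_of_notMem hσ hx) h

theorem involutionRestrict_mul_self :
    involutionRestrict σ hσ S * involutionRestrict σ hσ S = 1 :=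
  Equiv.ext (Function.Involutive.toPerm_involutive _)

theorem involutionRestrict_mul_of_disjoint (hST : Disjoint S T) :
    involutionRestrict σ hσ S * involutionRestrict σ hσ T = involutionRestrict σ hσ (S ∪ T) := by
  ext x
  have hx : σ (σ x) = x := DFunLike.congr_fun hσ x
  rw [Equiv.Perm.mul_apply]
  by_cases hT : s(x, σ x) ∈ T
  · have hS : s(σ x, σ (σ x)) ∉ S := by
      rw [hx, Sym2.eq_swap]
      exact fun h => Set.disjoint_left.1 hST h hT
    rw [involutionRestrict_of_mem hσ hT, involutionRestrict_of_notMem hσ hS,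
      involutionRestrict_of_mem hσ (Or.inr hT)]
  · rw [involutionRestrict_of_notMem hσ hT]
    by_cases hS : s(x, σ x) ∈ S
    · rw [involutionRestrict_of_mem hσ hS, involutionRestrict_of_mem hσ (Or.inl hS)]
    · rw [involutionRestrict_of_notMem hσ hS,
        involutionRestrict_of_notMem hσ (fun h => h.elim hS hT)]

theorem involutionRestrict_eq_self (h : ∀ x, σ x ≠ x → s(x, σ x) ∈ S) :
    involutionRestrict σ hσ S = σ := by
  ext x
  by_cases hx : s(x, σ x) ∈ S
  · exact involutionRestrict_of_mem hσ hx
  · rw [involutionRestrict_of_notMem hσ hx]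
    exact (not_not.1 (mt (h x) hx)).symm

theorem isRound_involutionRestrict_edgeSet (G : SimpleGraph V) :
    isRound G (involutionRestrict σ hσ G.edgeSet) :=
  ⟨involutionRestrict_mul_self hσ, fun _ h => mem_of_involutionRestrict_ne hσ h⟩

/-- If the part of `σ` in each of the pairwise disjoint classes `Es i` can be routed in `k`
rounds, then the part of `σ` in the union of the classes `i ∈ s` can be routed in `s.card * k`
rounds. -/
theorem routable_involutionRestrict_biUnion {G : SimpleGraph V} {ι : Type*} {k : ℕ}
    {Es : ι → Set (Sym2 V)} (hdisj : Pairwise fun i j => Disjoint (Es i) (Es j))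
    (hroute : ∀ i, Routable G k (involutionRestrict σ hσ (Es i))) (s : Finset ι) :
    Routable G (s.card * k) (involutionRestrict σ hσ (⋃ i ∈ s, Es i)) := by
  classical
  induction s using Finset.induction_on with
  | empty =>
    have h : involutionRestrict σ hσ (⋃ i ∈ (∅ : Finset ι), Es i) = 1 :=
      Equiv.ext fun x => involutionRestrict_of_notMem hσ (by simp)
    rw [h]
    exact Routable.one.mono (Nat.zero_le _)
  | insert i s hi ih =>
    rw [Finset.set_biUnion_insert, ← involutionRestrict_mul_of_disjoint hσ,
      Finset.card_insert_of_notMem hi]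
    · exact ((hroute i).mul ih).mono (by rw [add_mul, one_mul, add_comm])
    · rw [Set.disjoint_iUnion₂_right]
      exact fun j hj => hdisj (ne_of_mem_of_not_mem hj hi).symm

end involutionRestrict

/-- If every round of `G'` can be routed in `G` in `k` rounds, then every sequence of `m` rounds
of `G'` can be routed in `G` in `k * m` rounds. -/
theorem Routable.of_rounds {V : Type*} {G G' : SimpleGraph V} {k m : ℕ} {π : Equiv.Perm V}
    (hround : ∀ σ, isRound G' σ → Routable G k σ) (hπ : Routable G' m π) :
    Routable G (k * m) π := by
  obtain ⟨L, hL, hr, rfl⟩ := hπ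
  refine Routable.mono ?_ (Nat.mul_le_mul_left k hL)
  rw [rComp_eq_prod_reverse]
  clear hL
  induction L with
  | nil => exact Routable.one
  | cons σ L ih =>
    rw [List.reverse_cons, List.prod_append, List.prod_singleton, List.length_cons, mul_add_one]
    exact (ih fun τ hτ => hr τ (List.mem_cons_of_mem _ hτ)).mul
      (hround σ (hr σ List.mem_cons_self))

/-- Reduction between routing numbers of two graphs on the same vertex set: if the edges of
`G'` missing from `G` can be partitioned into `c` classes such that the swap permutation of
any set of pairwise vertex-disjoint edges within one class (i.e. any involution moving
vertices only along edges of that class) can be routed in `G` within `c'` rounds, then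
`rt(G) ≤ (1 + c * c') * rt(G')`. -/
theorem rt_reduction
    {V : Type*} [Fintype V] [DecidableEq V]
    (G G' : SimpleGraph V) (hG : G.Connected) (hG' : G'.Connected)
    (c c' : ℕ) (hc : 0 < c) (hc' : 0 < c')
    (Es : Fin c → Set (Sym2 V))
    (hdisj : Pairwise fun i j => Disjoint (Es i) (Es j))
    (hcover : (⋃ i, Es i) = G'.edgeSet \ G.edgeSet)
    (hroute : ∀ i : Fin c, ∀ σ : Equiv.Perm V, σ * σ = 1 →
      (∀ x : V, σ x ≠ x → s(x, σ x) ∈ Es i) → rtP G σ ≤ c') :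
    rt G ≤ (1 + c * c') * rt G' := by
  have hround : ∀ σ, isRound G' σ → Routable G (1 + c * c') σ := by
    rintro σ ⟨hσ, hadj⟩
    have hclass : ∀ i, Routable G c' (involutionRestrict σ hσ (Es i)) := fun i =>
      (hG.routable_rtP _).mono <| hroute i _ (involutionRestrict_mul_self hσ)
        fun _ h => mem_of_involutionRestrict_ne hσ h
    have hnew := routable_involutionRestrict_biUnion hσ hdisj hclass Finset.univ
    have hunion : (⋃ i ∈ (Finset.univ : Finset (Fin c)), Es i) = G'.edgeSet \ G.edgeSet := by
      simpa using hcover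
    rw [hunion, Finset.card_univ, Fintype.card_fin] at hnew
    have hmul := (Routable.of_isRound (isRound_involutionRestrict_edgeSet hσ G)).mul hnew
    rwa [involutionRestrict_mul_of_disjoint hσ Set.disjoint_sdiff_right, Set.union_sdiff_self,
      involutionRestrict_eq_self hσ fun x hx => Or.inr (hadj x hx)] at hmul
  refine Finset.sup_le fun π _ => ?_
  exact (((hG'.routable_rtP π).of_rounds hround).mono
    (Nat.mul_le_mul_left _ (Finset.le_sup (f := rtP G') (Finset.mem_univ π)))).rtP_le
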